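/- arXiv:math/0011123 — 8 statements merged into one kernel-verified Lean document; each statement's English description precedes it below -/
import Mathlib

section
/- Let R be a commutative ring and M an R-module. Suppose A is an m0 × m1 matrix over R and B is an n0 × n1 matrix over R such that the cokernel of the linear map R^{m1} → R^{m0} given by A and the cokernel of the linear map R^{n1} → R^{n0} given by B are both isomorphic to M as R-modules. Then for every natural number j, the ideal of R generated by all minors of A of size m0 − j equals the ideal of R generated by all minors of B of size n0 − j. -/
/-- The ideal of `R` generated by all minors of size `s` of the matrix `A`
(determinants of `s × s` submatrices obtained by choosing `s` rows and `s` columns;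
for `s = 0` this is the unit ideal, and if `s` exceeds the number of rows or
columns it is the zero ideal). -/
def minorsIdeal {R : Type*} [CommRing R] {m n : ℕ}
    (A : Matrix (Fin m) (Fin n) R) (s : ℕ) : Ideal R :=
  Ideal.span { x : R | ∃ (f : Fin s → Fin m) (g : Fin s → Fin n),
    x = ((A.submatrix f g)).det }

theorem minorsIdeal_zero {R : Type*} [CommRing R] {m n : ℕ} (A : Matrix (Fin m) (Fin n) R) :
    minorsIdeal A 0 = ⊤ :=
  (Ideal.eq_top_iff_one _).2 <| Ideal.subset_span
    ⟨Fin.elim0, Fin.elim0, (Matrix.det_isEmpty).symm⟩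

theorem minorsIdeal_submatrix_rows_le {R : Type*} [CommRing R] {m m' n : ℕ}
    (A : Matrix (Fin m) (Fin n) R) (r : Fin m' → Fin m) (s : ℕ) :
    minorsIdeal (A.submatrix r id) s ≤ minorsIdeal A s := by
  refine Ideal.span_le.2 ?_
  rintro _ ⟨f, g, rfl⟩
  exact Ideal.subset_span ⟨r ∘ f, g, rfl⟩

theorem det_mul_mem_minorsIdeal {R : Type*} [CommRing R] {k l : ℕ}
    (D : Matrix (Fin k) (Fin l) R) (V : Matrix (Fin l) (Fin k) R) :
    (D * V).det ∈ minorsIdeal D k := by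
  have hrows : (D * V).transpose = fun c => ∑ b, V b c • D.transpose b := by
    ext c i
    simp [Matrix.mul_apply, Finset.sum_apply, mul_comm]
  rw [← Matrix.det_transpose, hrows]
  change Matrix.detRowAlternating.toMultilinearMap _ ∈ _
  rw [MultilinearMap.map_sum]
  refine Ideal.sum_mem _ fun r _ => ?_
  rw [MultilinearMap.map_smul_univ]
  refine Ideal.mul_mem_left _ _ (Ideal.subset_span ⟨id, r, ?_⟩)
  rw [← Matrix.det_transpose]
  rfl

theorem card_preimage_succAbove_le {k : ℕ} (i : Fin (k + 1)) (U : Finset (Fin (k + 1))) :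
    (U.preimage i.succAbove i.succAbove_right_injective.injOn).card ≤ (U.erase i).card := by
  refine Finset.card_le_card_of_injOn i.succAbove (fun a ha => ?_)
    i.succAbove_right_injective.injOn
  simpa [Fin.succAbove_ne] using ha

/-- If a square matrix agrees with a product `D * V` outside the rows in `U` and the columns
in `C`, Laplace expansion along these rows and columns puts its determinant in an ideal of
minors of `D`. -/
theorem det_mem_minorsIdeal_of_eq_mul {R : Type*} [CommRing R] {l : ℕ} (t : ℕ) {k : ℕ}
    (X : Matrix (Fin k) (Fin k) R) (D : Matrix (Fin k) (Fin l) R) (V : Matrix (Fin l) (Fin k) R)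
    (U C : Finset (Fin k)) (hX : ∀ i ∉ U, ∀ c ∉ C, X i c = (D * V) i c)
    (hcard : t + U.card + C.card ≤ k) : X.det ∈ minorsIdeal D t := by
  induction k with
  | zero =>
    obtain rfl : t = 0 := by omega
    simp [minorsIdeal_zero]
  | succ k ih =>
    have minor_mem (i c : Fin (k + 1)) (h : t + (U.erase i).card + (C.erase c).card ≤ k) :
        (X.submatrix i.succAbove c.succAbove).det ∈ minorsIdeal D t := by
      refine minorsIdeal_submatrix_rows_le D i.succAbove t <|
        ih _ _ (V.submatrix id c.succAbove)
          (U.preimage i.succAbove i.succAbove_right_injective.injOn)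
          (C.preimage c.succAbove c.succAbove_right_injective.injOn) (fun a ha b hb => ?_) ?_
      · rw [Finset.mem_preimage] at ha hb
        simpa [Matrix.mul_apply] using hX _ ha _ hb
      · have := card_preimage_succAbove_le i U
        have := card_preimage_succAbove_le c C
        omega
    have erase_le (S : Finset (Fin (k + 1))) (i) : (S.erase i).card ≤ S.card :=
      Finset.card_le_card (S.erase_subset i)
    by_cases hC : C.Nonempty
    · obtain ⟨c, hc⟩ := hC
      rw [Matrix.det_succ_column X c]
      refine Ideal.sum_mem _ fun i _ => Ideal.mul_mem_left _ _ (minor_mem i c ?_)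
      have := erase_le U i
      have := Finset.card_erase_lt_of_mem hc
      omega
    obtain rfl := Finset.not_nonempty_iff_eq_empty.1 hC
    by_cases hU : U.Nonempty
    · obtain ⟨i, hi⟩ := hU
      rw [Matrix.det_succ_row X i]
      refine Ideal.sum_mem _ fun c _ => Ideal.mul_mem_left _ _ (minor_mem i c ?_)
      have := erase_le ∅ c
      have := Finset.card_erase_lt_of_mem hi
      omega
    obtain rfl := Finset.not_nonempty_iff_eq_empty.1 hU
    by_cases ht : t = k + 1
    · subst ht
      obtain rfl : X = D * V := by
        ext i c
        exact hX i (by simp) c (by simp)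
      exact det_mul_mem_minorsIdeal D V
    · rw [Matrix.det_succ_row_zero]
      refine Ideal.sum_mem _ fun c _ => Ideal.mul_mem_left _ _ (minor_mem 0 c ?_)
      simp at hcard ⊢
      omega

/-- A square submatrix completed by standard basis columns has the same determinant. -/
theorem det_extend_columns {R ι κ : Type*} [CommRing R] [Fintype ι] [DecidableEq ι]
    [Fintype κ] [DecidableEq κ] {f : κ → ι} (hf : Function.Injective f) (a : κ → ι → R) :
    (Matrix.of fun i c => Function.extend f a (fun c => Pi.single c 1) c i).det =
      (Matrix.of fun i c => a c (f i)).det := by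
  classical
  rw [Matrix.twoBlockTriangular_det' _ fun c => ∃ p, f p = c]
  · have hone : (Matrix.of fun i c => Function.extend f a
        (fun c => Pi.single c 1) c i).toSquareBlockProp (fun c => ¬ ∃ p, f p = c) = 1 := by
      ext i c
      have hc : ¬ ∃ p, f p = c := c.2
      simp [Matrix.toSquareBlockProp_def, Function.extend_apply' _ _ _ hc, Matrix.one_apply,
        Pi.single_apply, Subtype.ext_iff]
    let e : κ ≃ {c // ∃ p, f p = c} := Equiv.ofInjective f hf
    rw [hone, Matrix.det_one, mul_one, ← Matrix.det_submatrix_equiv_self e]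
    congr 1
    ext i c
    exact congrFun (hf.extend_apply a (fun c => Pi.single c 1) c) (f i)
  · intro i hi c hc
    have hic : i ≠ c := fun h => hc (h ▸ hi)
    simp [Function.extend_apply' _ _ _ hc, hic]

theorem minorsIdeal_fromRows_zero_le {R : Type*} [CommRing R] {m n0 n1 : ℕ}
    (B : Matrix (Fin n0) (Fin n1) R) (s : ℕ) :
    minorsIdeal ((Matrix.fromRows (0 : Matrix (Fin m) (Fin n1) R) B).submatrix
      finSumFinEquiv.symm id) s ≤ minorsIdeal B s := by
  refine Ideal.span_le.2 ?_
  rintro _ ⟨f, g, rfl⟩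
  by_cases h : ∃ i a, finSumFinEquiv.symm (f i) = Sum.inl a
  · obtain ⟨i, a, h⟩ := h
    rw [Matrix.det_eq_zero_of_row_eq_zero i fun c => by simp [h]]
    exact zero_mem _
  · have h' (i) : ∃ b, finSumFinEquiv.symm (f i) = Sum.inr b := by
      cases hi : finSumFinEquiv.symm (f i) with
      | inl a => exact (h ⟨i, a, hi⟩).elim
      | inr b => exact ⟨b, rfl⟩
    choose r hr using h'
    refine Ideal.subset_span ⟨r, g, ?_⟩
    congr 1
    ext i c
    simp [hr]

theorem minorsIdeal_le_of_mul_eq {R : Type*} [CommRing R] {m0 m1 n0 n1 : ℕ}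
    {A : Matrix (Fin m0) (Fin m1) R} {B : Matrix (Fin n0) (Fin n1) R}
    {P : Matrix (Fin n0) (Fin m0) R} {Q : Matrix (Fin m0) (Fin n0) R}
    {V : Matrix (Fin n1) (Fin m1) R} {W : Matrix (Fin n1) (Fin n0) R}
    (hV : P * A = B * V) (hW : 1 - P * Q = B * W) (j : ℕ) :
    minorsIdeal A (m0 - j) ≤ minorsIdeal B (n0 - j) := by
  classical
  refine Ideal.span_le.2 ?_
  rintro _ ⟨f, g, rfl⟩
  by_cases hj : n0 ≤ j
  · simp [Nat.sub_eq_zero_of_le hj, minorsIdeal_zero]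
  by_cases hf : Function.Injective f
  swap
  · obtain ⟨a, b, hab, hne⟩ := Function.not_injective_iff.1 hf
    rw [Matrix.det_zero_of_row_eq hne (by ext c; simp [hab])]
    exact zero_mem _
  set N : Matrix (Fin m0) (Fin m0) R :=
    Matrix.of fun i c => Function.extend f (fun p i => A i (g p)) (fun c => Pi.single c 1) c i
    with hN
  set T : Matrix (Fin n1) (Fin m0) R :=
    Matrix.of fun i c => Function.extend f (fun p i => V i (g p)) 0 c i with hT
  have hdet : (Matrix.fromBlocks N (-Q) (P * N) (1 - P * Q)).det = (A.submatrix f g).det := by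
    have hmul : Matrix.fromBlocks N (-Q) (P * N) (1 - P * Q) =
        Matrix.fromBlocks 1 0 P 1 * Matrix.fromBlocks N (-Q) 0 1 := by
      simp [Matrix.fromBlocks_multiply, sub_eq_neg_add]
    rw [hmul, Matrix.det_mul, Matrix.det_fromBlocks_zero₁₂, Matrix.det_fromBlocks_zero₂₁]
    simp only [Matrix.det_one, one_mul, mul_one]
    exact det_extend_columns hf fun p i => A i (g p)
  have hcol (b : Fin n0) (p) : (P * N) b (f p) = (B * T) b (f p) := by
    have := congrFun (congrFun hV b) (g p)
    simpa [Matrix.mul_apply, hN, hT, hf.extend_apply] using this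
  rw [SetLike.mem_coe, ← hdet, ← Matrix.det_submatrix_equiv_self finSumFinEquiv.symm]
  refine minorsIdeal_fromRows_zero_le (m := m0) B _ <|
    det_mem_minorsIdeal_of_eq_mul (n0 - j) _ _
      ((Matrix.fromCols T W).submatrix id finSumFinEquiv.symm)
      (Finset.univ.map (Fin.castAddEmb n0))
      ((Finset.univ.map ⟨f, hf⟩)ᶜ.map (Fin.castAddEmb n0)) (fun i hi c hc => ?_) ?_
  · obtain ⟨i, rfl⟩ := finSumFinEquiv.surjective i
    obtain ⟨c, rfl⟩ := finSumFinEquiv.surjective c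
    rcases i with i | i
    · simp at hi
    rcases c with c | c
    · obtain ⟨p, rfl⟩ : ∃ p, f p = c := by simpa using hc
      simpa [Matrix.mul_apply] using hcol i p
    · have := congrFun (congrFun hW i) c
      simpa [Matrix.mul_apply] using this
  · simp [Finset.card_compl]
    omega

theorem exists_surjective_ker_eq_range {R M F : Type*} [Ring R] [AddCommGroup M] [Module R M]
    [AddCommGroup F] [Module R F] {K : Submodule R F} (e : (F ⧸ K) ≃ₗ[R] M) :
    ∃ v : F →ₗ[R] M, Function.Surjective v ∧ LinearMap.ker v = K :=
  ⟨e.toLinearMap ∘ₗ K.mkQ, e.surjective.comp K.mkQ_surjective, by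
    rw [LinearEquiv.ker_comp, Submodule.ker_mkQ]⟩

theorem Matrix.exists_eq_mul_of_range_le {R l m n : Type*} [CommRing R] [Fintype l]
    [DecidableEq l] [Fintype n] (B : Matrix m n R) (Y : Matrix m l R)
    (h : LinearMap.range Y.mulVecLin ≤ LinearMap.range B.mulVecLin) :
    ∃ V : Matrix n l R, Y = B * V := by
  have hcol (c : l) : ∃ x, B.mulVecLin x = Y.mulVecLin (Pi.single c 1) :=
    h (LinearMap.mem_range_self _ _)
  choose x hx using hcol
  refine ⟨Matrix.of fun i c => x c i, ?_⟩
  ext i c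
  simpa [Matrix.mul_apply, Matrix.mulVec, dotProduct, Pi.single_apply] using (congrFun (hx c) i).symm

theorem minorsIdeal_le_of_presentations {R M : Type*} [CommRing R] [AddCommGroup M] [Module R M]
    {m0 m1 n0 n1 : ℕ} {A : Matrix (Fin m0) (Fin m1) R} {B : Matrix (Fin n0) (Fin n1) R}
    {v : (Fin m0 → R) →ₗ[R] M} {w : (Fin n0 → R) →ₗ[R] M}
    (hv : Function.Surjective v) (hw : Function.Surjective w)
    (hvA : LinearMap.ker v = LinearMap.range A.mulVecLin)
    (hwB : LinearMap.ker w = LinearMap.range B.mulVecLin) (j : ℕ) :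
    minorsIdeal A (m0 - j) ≤ minorsIdeal B (n0 - j) := by
  obtain ⟨p, hp⟩ := Module.projective_lifting_property w v hw
  obtain ⟨q, hq⟩ := Module.projective_lifting_property v w hv
  have hp' (x) : w (p x) = v x := LinearMap.congr_fun hp x
  have hq' (x) : v (q x) = w x := LinearMap.congr_fun hq x
  obtain ⟨V, hV⟩ := B.exists_eq_mul_of_range_le (LinearMap.toMatrix' p * A) <| by
    rw [← hwB]
    rintro _ ⟨x, rfl⟩
    have hx : A.mulVec x ∈ LinearMap.ker v := hvA ▸ ⟨x, rfl⟩
    simpa [← Matrix.mulVec_mulVec, hp', LinearMap.toMatrix'_mulVec] using hx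
  obtain ⟨W, hW⟩ := B.exists_eq_mul_of_range_le
      (1 - LinearMap.toMatrix' p * LinearMap.toMatrix' q) <| by
    rw [← hwB]
    rintro _ ⟨x, rfl⟩
    simp [hp', hq', LinearMap.toMatrix'_mulVec]
  exact minorsIdeal_le_of_mul_eq hV hW j

/-- **Fitting's lemma**: the Fitting ideals of a module are independent of the chosen
matrix presentation.  If the cokernels of the linear maps given by matrices `A` and `B`
are both isomorphic to `M`, then for every `j` the ideal of minors of `A` of size
`m0 - j` agrees with the ideal of minors of `B` of size `n0 - j`. -/
theorem fitting_ideal_well_defined {R M : Type*} [CommRing R] [AddCommGroup M] [Module R M]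
    {m0 m1 n0 n1 : ℕ} (A : Matrix (Fin m0) (Fin m1) R) (B : Matrix (Fin n0) (Fin n1) R)
    (hA : Nonempty ((((Fin m0) → R) ⧸ LinearMap.range A.mulVecLin) ≃ₗ[R] M))
    (hB : Nonempty ((((Fin n0) → R) ⧸ LinearMap.range B.mulVecLin) ≃ₗ[R] M)) :
    ∀ j : ℕ, minorsIdeal A (m0 - j) = minorsIdeal B (n0 - j) := by
  intro j
  obtain ⟨v, hv, hvA⟩ := exists_surjective_ker_eq_range hA.some
  obtain ⟨w, hw, hwB⟩ := exists_surjective_ker_eq_range hB.some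
  exact le_antisymm (minorsIdeal_le_of_presentations hv hw hvA hwB j)
    (minorsIdeal_le_of_presentations hw hv hwB hvA j)
end

section
/- Let R be a commutative ring and let f0, f1 ∈ R[x] be monic polynomials of degrees d0 and d1 respectively. If every minor of size d1 + 1 of the Sylvester-type matrix Z(f0, f1) is zero, then f0 divides f1 in R[x]. -/
/-- The Sylvester-type matrix `Z(f0, f1)` of two polynomials: a square matrix of size
`d0 + d1` whose first `d1` columns record the coefficients of `x^j * f0` for `0 ≤ j < d1`
and whose last `d0` columns record the coefficients of `x^j * f1` for `0 ≤ j < d0`, with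
respect to the basis `1, x, …, x^{d0+d1-1}`. -/
noncomputable def sylvesterMatrix {R : Type*} [CommRing R] (d0 d1 : ℕ)
    (f0 f1 : Polynomial R) : Matrix (Fin (d0 + d1)) (Fin (d0 + d1)) R :=
  Matrix.of fun i j =>
    if (j : ℕ) < d1 then (Polynomial.X ^ (j : ℕ) * f0).coeff i
    else (Polynomial.X ^ ((j : ℕ) - d1) * f1).coeff i

open Polynomial in
/-- If the quotient of `f` by a monic `q` has degree less than `n`, then the coefficient of `x^i` in the
remainder is the minor of size `n + 1` of the coefficient matrix of `f, q, x q, …, x^(n-1) q`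
with rows `i, deg q, …, deg q + n - 1`. -/
theorem Polynomial.det_coeff_eq_coeff_modByMonic {R : Type*} [CommRing R] {n : ℕ} {f q : R[X]}
    (hq : q.Monic) (hn : (f /ₘ q).degree < n) (i : ℕ) :
    (Matrix.of fun a b : Fin (n + 1) =>
      (Fin.cons (α := fun _ => R[X]) f (fun k : Fin n => X ^ (k : ℕ) * q) b).coeff
        (Fin.cons (α := fun _ => ℕ) i (fun k : Fin n => q.natDegree + k) a)).det = (f %ₘ q).coeff i := by
  set M := Matrix.of fun a b : Fin (n + 1) =>
      (Fin.cons (α := fun _ => R[X]) f (fun k : Fin n => X ^ (k : ℕ) * q) b).coeff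
        (Fin.cons (α := fun _ => ℕ) i (fun k : Fin n => q.natDegree + k) a) with hM
  nontriviality R
  let c : Fin (n + 1) → R := Fin.cons 1 fun k : Fin n => -(f /ₘ q).coeff k
  have hdiv : f /ₘ q = ∑ k : Fin n, C ((f /ₘ q).coeff k) * X ^ (k : ℕ) := by
    rw [Fin.sum_univ_eq_sum_range (fun k => C ((f /ₘ q).coeff k) * X ^ k)]
    by_cases h : f /ₘ q = 0
    · simp [h]
    · exact as_sum_range_C_mul_X_pow' _ ((natDegree_lt_iff_degree_lt h).2 hn)
  have hcol (a : Fin (n + 1)) : ∑ b, c b • M a b =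
      (f %ₘ q).coeff (Fin.cons (α := fun _ => ℕ) i (fun k : Fin n => q.natDegree + k) a) := by
    rw [modByMonic_eq_sub_mul_div, mul_comm]
    conv_rhs => rw [hdiv]
    simp [Fin.sum_univ_succ, c, hM, Finset.sum_mul, mul_assoc, sub_eq_add_neg]
  have hdet := Matrix.det_updateCol_sum M 0 c
  rw [show c 0 = 1 from rfl, one_smul] at hdet
  simp only [hcol] at hdet
  rw [← hdet, Matrix.det_of_isUpperTriangular, Fin.prod_univ_succ]
  · simp [hM, add_comm q.natDegree, coeff_X_pow_mul', hq]
  · intro a b hab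
    obtain ⟨a, rfl⟩ := Fin.exists_succ_eq.2 (Fin.ne_zero_of_lt hab)
    cases b using Fin.cases with
    | zero =>
      simp only [Matrix.updateCol_self, Fin.cons_succ]
      exact coeff_eq_zero_of_degree_lt ((degree_modByMonic_lt f hq).trans_le
        (degree_le_natDegree.trans (by exact_mod_cast Nat.le_add_right _ _)))
    | succ b =>
      have hab : (b : ℕ) < a := by simpa using hab
      simp only [Matrix.updateCol_apply, Fin.succ_ne_zero, if_false, hM, Matrix.of_apply,
        Fin.cons_succ, coeff_X_pow_mul']
      rw [if_pos (by lia)]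
      exact coeff_eq_zero_of_natDegree_lt (by lia)

/-- If every minor of size `d1 + 1` of the Sylvester-type matrix `Z(f0, f1)` of two monic
polynomials of degrees `d0` and `d1` vanishes, then `f0` divides `f1`. -/
theorem dvd_of_minors_eq_zero {R : Type*} [CommRing R] (d0 d1 : ℕ) (f0 f1 : Polynomial R)
    (h0 : f0.Monic) (h0d : f0.natDegree = d0) (h1 : f1.Monic) (h1d : f1.natDegree = d1)
    (hmin : ∀ (rows cols : Fin (d1 + 1) → Fin (d0 + d1)),
      (((sylvesterMatrix d0 d1 f0 f1).submatrix rows cols)).det = 0) :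
    f0 ∣ f1 := by
  nontriviality R
  subst h0d h1d
  rcases Nat.eq_zero_or_pos f0.natDegree with hd | hd
  · rw [h0.natDegree_eq_zero.1 hd]
    exact one_dvd _
  rw [← Polynomial.modByMonic_eq_zero_iff_dvd h0]
  ext i
  rw [Polynomial.coeff_zero]
  rcases lt_or_ge i f0.natDegree with hi | hi
  · have hdeg : (f1 /ₘ f0).degree < f1.natDegree := by
      rw [← Polynomial.degree_eq_natDegree h1.ne_zero]
      exact Polynomial.degree_divByMonic_lt f1 f0 h1.ne_zero
        (Polynomial.natDegree_pos_iff_degree_pos.1 hd)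
    rw [← Polynomial.det_coeff_eq_coeff_modByMonic h0 hdeg i,
      ← hmin (Fin.cons ⟨i, by lia⟩ fun k => Fin.natAdd f0.natDegree k)
        (Fin.cons ⟨f1.natDegree, by lia⟩ fun k => ⟨k, by lia⟩)]
    congr 1
    ext a b
    cases a using Fin.cases <;> cases b using Fin.cases <;> simp [sylvesterMatrix]
  · exact Polynomial.coeff_eq_zero_of_degree_lt ((Polynomial.degree_modByMonic_lt f1 h0).trans_le
      (Polynomial.degree_le_natDegree.trans (by exact_mod_cast hi)))
end

section
/- Let R be a commutative ring, let f0, f1 ∈ R[x] be monic polynomials of degrees d0 and d1 respectively, and suppose there is a monic polynomial g ∈ R[x] of degree k dividing both f0 and f1 in R[x]. Then every minor of size d0 + d1 − k + 1 of the Sylvester-type matrix Z(f0, f1) is zero. -/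
open Polynomial in
/-- The coefficients of `q * g` as a combination of those of the shifts `X ^ m * g`. -/
theorem Polynomial.coeff_mul_eq_sum_coeff_X_pow_mul {R : Type*} [CommRing R] (g : R[X]) {q : R[X]}
    {N : ℕ} (hq : q.natDegree < N) (i : ℕ) :
    (q * g).coeff i = ∑ m : Fin N, (X ^ (m : ℕ) * g).coeff i * q.coeff m := by
  conv_lhs => rw [q.as_sum_range_C_mul_X_pow' hq]
  rw [Finset.sum_mul, finsetSum_coeff, Finset.sum_range]
  refine Finset.sum_congr rfl fun m _ => ?_
  rw [mul_assoc, coeff_C_mul, mul_comm]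

open Polynomial in
/-- If every column of a matrix lists coefficients of a multiple `q * g` with `q` of degree less
than `N`, then its minors of size `N + 1` vanish. -/
theorem Matrix.det_submatrix_eq_zero_of_coeff_mul {R : Type*} [CommRing R] {n N : ℕ} (g : R[X])
    (A : Matrix (Fin n) (Fin n) R)
    (hA : ∀ j, ∃ q : R[X], q.natDegree < N ∧ ∀ i, A i j = (q * g).coeff i)
    (rows cols : Fin (N + 1) → Fin n) : (A.submatrix rows cols).det = 0 := by
  choose q hqN hq using hA
  have hfac : A.submatrix rows cols =
      (Matrix.of fun i m : Fin (N + 1) => (X ^ (m : ℕ) * g).coeff (rows i)) *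
        Matrix.of fun m j : Fin (N + 1) => (q (cols j)).coeff m := by
    ext i j
    simp only [Matrix.submatrix_apply, Matrix.mul_apply, Matrix.of_apply, hq]
    exact coeff_mul_eq_sum_coeff_X_pow_mul g ((hqN _).trans N.lt_succ_self) _
  rw [hfac, Matrix.det_mul]
  refine mul_eq_zero_of_right _ (Matrix.det_eq_zero_of_row_eq_zero (Fin.last N) fun j => ?_)
  exact coeff_eq_zero_of_natDegree_lt (hqN _)

/-- If the monic polynomials `f0` and `f1`, of degrees `d0` and `d1`, have a common monic
divisor of degree `k`, then every minor of size `d0 + d1 - k + 1` of the Sylvester-type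
matrix `Z(f0, f1)` vanishes. -/
theorem minors_eq_zero_of_common_divisor {R : Type*} [CommRing R] (d0 d1 k : ℕ)
    (f0 f1 g : Polynomial R)
    (h0 : f0.Monic) (h0d : f0.natDegree = d0) (h1 : f1.Monic) (h1d : f1.natDegree = d1)
    (hg : g.Monic) (hgd : g.natDegree = k) (hg0 : g ∣ f0) (hg1 : g ∣ f1) :
    ∀ (rows cols : Fin (d0 + d1 - k + 1) → Fin (d0 + d1)),
      (((sylvesterMatrix d0 d1 f0 f1).submatrix rows cols)).det = 0 := by
  subst h0d h1d hgd
  intro rows cols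
  nontriviality R
  obtain ⟨p0, rfl⟩ := hg0
  obtain ⟨p1, rfl⟩ := hg1
  have hp0 : p0.Monic := hg.of_mul_monic_left h0
  have hp1 : p1.Monic := hg.of_mul_monic_left h1
  have hdeg0 := hg.natDegree_mul hp0
  have hdeg1 := hg.natDegree_mul hp1
  refine Matrix.det_submatrix_eq_zero_of_coeff_mul g _ (fun j => ?_) rows cols
  by_cases hj : (j : ℕ) < (g * p1).natDegree
  · refine ⟨Polynomial.X ^ (j : ℕ) * p0, ?_, fun i => ?_⟩
    · rw [(Polynomial.monic_X_pow _).natDegree_mul hp0, Polynomial.natDegree_X_pow]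
      omega
    · simp only [sylvesterMatrix, Matrix.of_apply, if_pos hj]
      exact congrArg (fun p : Polynomial R => p.coeff i) (by ring)
  · refine ⟨Polynomial.X ^ ((j : ℕ) - (g * p1).natDegree) * p1, ?_, fun i => ?_⟩
    · rw [(Polynomial.monic_X_pow _).natDegree_mul hp1, Polynomial.natDegree_X_pow]
      omega
    · simp only [sylvesterMatrix, Matrix.of_apply, if_neg hj]
      exact congrArg (fun p : Polynomial R => p.coeff i) (by ring)
end

section
/- Let R be a commutative ring, f ∈ R[t] a polynomial, and A = R[x_0,…,x_{k−1}] a polynomial ring. With p_i, q_i, r_i, b_i as defined in the division scheme, the ideal of A generated by the coefficients of the remainder r_k equals the ideal of A generated by b_0, b_1, …, b_{k−1}. -/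
/-- `divP R k i` is the monic polynomial `p_i(t) = ∏_{j < i} (t - x_j)` in `A[t]`,
where `A = R[x_0, …, x_{k-1}]`. -/
noncomputable def divP (R : Type*) [CommRing R] (k : ℕ) (i : ℕ) :
    Polynomial (MvPolynomial (Fin k) R) :=
  ∏ j ∈ Finset.univ.filter (fun j : Fin k => (j : ℕ) < i),
    (Polynomial.X - Polynomial.C (MvPolynomial.X j))

/-- The polynomial `f ∈ R[t]` regarded as an element of `A[t]`,
where `A = R[x_0, …, x_{k-1}]`. -/
noncomputable def divF (R : Type*) [CommRing R] (k : ℕ) (f : Polynomial R) :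
    Polynomial (MvPolynomial (Fin k) R) :=
  f.map MvPolynomial.C

/-- `divB R k f i = b_i = q_i(x_i)`, the evaluation at `x_i` of the quotient `q_i` of `f`
upon division by the monic polynomial `p_i`. -/
noncomputable def divB (R : Type*) [CommRing R] (k : ℕ) (f : Polynomial R) (i : Fin k) :
    MvPolynomial (Fin k) R :=
  Polynomial.eval (MvPolynomial.X i) (divF R k f /ₘ divP R k i)

namespace Polynomial

variable {A : Type*} [CommRing A]

/-- Newton's expansion of the remainder modulo `∏ j < n, (X - x j)`. -/
theorem modByMonic_prod_X_sub_C (f : A[X]) (x : ℕ → A) (n : ℕ) :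
    f %ₘ ∏ j ∈ Finset.range n, (X - C (x j)) =
      ∑ i ∈ Finset.range n,
        C (eval (x i) (f /ₘ ∏ j ∈ Finset.range i, (X - C (x j)))) *
          ∏ j ∈ Finset.range i, (X - C (x j)) := by
  nontriviality A
  have monic (m : ℕ) : (∏ j ∈ Finset.range m, (X - C (x j))).Monic :=
    monic_prod_of_monic _ _ fun j _ => monic_X_sub_C (x j)
  have deg (m : ℕ) : (∏ j ∈ Finset.range m, (X - C (x j))).degree = (m : WithBot ℕ) := by
    rw [degree_eq_natDegree (monic m).ne_zero, natDegree_finsetProd_X_sub_C_eq_card,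
      Finset.card_range]
  induction n with
  | zero => simp
  | succ n ih =>
    rw [Finset.sum_range_succ, ← ih]
    set p := ∏ j ∈ Finset.range n, (X - C (x j)) with hp
    set q := f /ₘ p with hq
    refine (div_modByMonic_unique (q /ₘ (X - C (x n))) _ (monic (n + 1)) ⟨?_, ?_⟩).2
    · rw [Finset.prod_range_succ, ← hp]
      have h₁ := modByMonic_add_div f p
      have h₂ := modByMonic_add_div q (X - C (x n))
      rw [modByMonic_X_sub_C_eq_C_eval] at h₂
      rw [← hq] at h₁
      linear_combination h₁ + p * h₂
    · rw [deg]
      refine (degree_add_le _ _).trans_lt (max_lt ?_ ?_)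
      · refine (degree_modByMonic_lt _ (monic n)).trans ?_
        rw [deg]
        exact_mod_cast n.lt_succ_self
      · rw [C_mul']
        refine (degree_smul_le _ _).trans_lt ?_
        rw [hp, deg]
        exact_mod_cast n.lt_succ_self

/-- If `p i` is monic of degree `i`, then an ideal contains all coefficients of
`∑ i < n, c i * p i` if and only if it contains all of the scalars `c i`. -/
theorem coeff_sum_C_mul_mem_iff {p : ℕ → A[X]} (monic : ∀ i, (p i).Monic)
    (deg : ∀ i, (p i).natDegree = i) (c : ℕ → A) (I : Ideal A) (n : ℕ) :
    (∀ m, (∑ i ∈ Finset.range n, C (c i) * p i).coeff m ∈ I) ↔ ∀ i < n, c i ∈ I := by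
  refine ⟨fun h => ?_, fun h m => ?_⟩
  · induction n with
    | zero => simp
    | succ n ih =>
      have hlead : c n ∈ I := by
        have hn := h n
        rw [Finset.sum_range_succ, coeff_add, finsetSum_coeff, Finset.sum_eq_zero, zero_add,
          coeff_C_mul] at hn
        · have h1 : (p n).coeff n = 1 := by simpa only [deg] using (monic n).coeff_natDegree
          rwa [h1, mul_one] at hn
        · intro i hi
          rw [coeff_C_mul, coeff_eq_zero_of_natDegree_lt, mul_zero]
          rw [deg]
          exact Finset.mem_range.mp hi
      intro i hi
      rcases Nat.lt_succ_iff_lt_or_eq.mp hi with hi | rfl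
      · refine ih (fun m => ?_) i hi
        have hm := h m
        rw [Finset.sum_range_succ, coeff_add, coeff_C_mul] at hm
        exact (I.add_mem_iff_left (I.mul_mem_right _ hlead)).mp hm
      · exact hlead
  · rw [finsetSum_coeff]
    refine I.sum_mem fun i hi => ?_
    rw [coeff_C_mul]
    exact I.mul_mem_right _ (h i (Finset.mem_range.mp hi))

end Polynomial

theorem divP_eq_prod_range (R : Type*) [CommRing R] {k i : ℕ} (hi : i ≤ k)
    {x : ℕ → MvPolynomial (Fin k) R} (hx : ∀ j : Fin k, x j = MvPolynomial.X j) :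
    divP R k i = ∏ j ∈ Finset.range i, (Polynomial.X - Polynomial.C (x j)) := by
  refine Finset.prod_bij (fun j _ => (j : ℕ)) (fun j hj => ?_) (fun _ _ _ _ h => Fin.ext h)
    (fun j hj => ?_) (fun j _ => by rw [hx])
  · simpa using hj
  · have hji := Finset.mem_range.mp hj
    exact ⟨⟨j, hji.trans_le hi⟩, by simpa using hji, rfl⟩

/-- The ideal of `A = R[x_0, …, x_{k-1}]` generated by the coefficients of the remainder
`r_k` of `f` upon division by `p_k(t) = ∏_{j<k}(t - x_j)` equals the ideal generated by
the elements `b_0, …, b_{k-1}`. -/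
theorem span_coeff_mod_eq_span_b {R : Type*} [CommRing R] (k : ℕ) (f : Polynomial R) :
    Ideal.span (Set.range (divF R k f %ₘ divP R k k).coeff) =
      Ideal.span (Set.range (divB R k f)) := by
  nontriviality R
  obtain ⟨x, hx⟩ : ∃ x : ℕ → MvPolynomial (Fin k) R, ∀ j : Fin k, x j = MvPolynomial.X j :=
    ⟨fun j => if h : j < k then MvPolynomial.X ⟨j, h⟩ else 0, fun j => by simp⟩
  have hb (i : Fin k) : divB R k f i = Polynomial.eval (x i)
      (divF R k f /ₘ ∏ j ∈ Finset.range i, (Polynomial.X - Polynomial.C (x j))) := by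
    rw [divB, divP_eq_prod_range R i.is_lt.le hx, hx]
  have key (I : Ideal (MvPolynomial (Fin k) R)) :
      Ideal.span (Set.range (divF R k f %ₘ divP R k k).coeff) ≤ I ↔
        Ideal.span (Set.range (divB R k f)) ≤ I := by
    simp only [Ideal.span_le, Set.range_subset_iff, SetLike.mem_coe]
    rw [divP_eq_prod_range R le_rfl hx, Polynomial.modByMonic_prod_X_sub_C,
      Polynomial.coeff_sum_C_mul_mem_iff
        (fun i => Polynomial.monic_prod_of_monic _ _ fun j _ => Polynomial.monic_X_sub_C (x j))
        (fun i => by rw [Polynomial.natDegree_finsetProd_X_sub_C_eq_card, Finset.card_range])]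
    simp only [hb]
    exact ⟨fun h i => h i i.is_lt, fun h i hi => h ⟨i, hi⟩⟩
  exact le_antisymm ((key _).mpr le_rfl) ((key _).mp le_rfl)
end

section
/- Let R be a commutative ring, f ∈ R[t] a polynomial, k ≥ 1, and A = R[x_0,…,x_{k−1}] a polynomial ring. Let v_k = ∏_{0 ≤ i < j < k} (x_j − x_i) be the Vandermonde determinant, and let B_k be the k×k matrix over A with entries (B_k)_{ij} = x_i^j for 0 ≤ j < k − 1 and (B_k)_{i,k−1} = f(x_i), for 0 ≤ i < k. With q_{k−1} the quotient of f upon division by the monic polynomial p_{k−1}(t) = ∏_{j<k−1}(t − x_j), one has det(B_k) = v_k · q_{k−1}(x_{k−1}) in A. Moreover v_k is not a zero-divisor in A. -/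
/-- The Vandermonde element `v_k = ∏_{0 ≤ i < j < k} (x_j - x_i)` in
`A = R[x_0, …, x_{k-1}]`. -/
noncomputable def vandermondeEl (R : Type*) [CommRing R] (k : ℕ) : MvPolynomial (Fin k) R :=
  ∏ j : Fin k, ∏ i ∈ Finset.univ.filter (fun i : Fin k => i < j),
    (MvPolynomial.X j - MvPolynomial.X i)

/-- The matrix `B_k` with entries `(B_k)_{ij} = x_i^j` for `j < k - 1` and
`(B_k)_{i,k-1} = f(x_i)`. -/
noncomputable def vandermondeFMatrix (R : Type*) [CommRing R] (k : ℕ) (f : Polynomial R) :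
    Matrix (Fin k) (Fin k) (MvPolynomial (Fin k) R) :=
  Matrix.of fun i j =>
    if (j : ℕ) < k - 1 then (MvPolynomial.X i) ^ (j : ℕ)
    else Polynomial.eval (MvPolynomial.X i) (divF R k f)

open Polynomial in
/-- Replacing the last column of a Vandermonde matrix by the values of a polynomial of degree at
most `n` multiplies the determinant by the coefficient of degree `n`. -/
theorem Matrix.det_updateCol_vandermonde_eval {S : Type*} [CommRing S] {n : ℕ}
    (v : Fin (n + 1) → S) {g : S[X]} (hg : g.natDegree < n + 1) :
    ((Matrix.vandermonde v).updateCol (Fin.last n) fun i => g.eval (v i)).det =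
      g.coeff n * (Matrix.vandermonde v).det := by
  have h := Matrix.det_updateCol_sum (Matrix.vandermonde v) (Fin.last n) fun j => g.coeff j
  simpa [Polynomial.eval_eq_sum_range' hg, ← Fin.sum_univ_eq_sum_range, Matrix.vandermonde_apply]
    using h

open Polynomial in
/-- Replacing the last column of a Vandermonde matrix by the values of an arbitrary polynomial `F`
multiplies the determinant by the value at the last node of the quotient of `F` by a monic
polynomial of degree `n` vanishing at all the other nodes. -/
theorem Matrix.det_updateCol_vandermonde_eval_divByMonic {S : Type*} [CommRing S] {n : ℕ}
    (v : Fin (n + 1) → S) (F : S[X]) {p : S[X]} (hp : p.Monic) (hdeg : p.natDegree = n)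
    (hroot : ∀ i, i ≠ Fin.last n → p.eval (v i) = 0) :
    ((Matrix.vandermonde v).updateCol (Fin.last n) fun i => F.eval (v i)).det =
      (Matrix.vandermonde v).det * (F /ₘ p).eval (v (Fin.last n)) := by
  nontriviality S
  set c := (F /ₘ p).eval (v (Fin.last n))
  have hr : (F %ₘ p).degree < n := by
    simpa [Polynomial.degree_eq_natDegree hp.ne_zero, hdeg] using degree_modByMonic_lt F hp
  have hg : (F %ₘ p + C c * p).natDegree < n + 1 := by
    refine Nat.lt_succ_of_le (natDegree_add_le_of_degree_le ?_ ?_)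
    · exact natDegree_le_of_degree_le hr.le
    · exact (natDegree_C_mul_le c p).trans hdeg.le
  have heval : ∀ i, F.eval (v i) = (F %ₘ p + C c * p).eval (v i) := by
    intro i
    conv_lhs => rw [← modByMonic_add_div F p]
    by_cases hi : i = Fin.last n
    · subst hi
      simp [c, mul_comm]
    · simp [hroot i hi]
  simp_rw [heval]
  rw [Matrix.det_updateCol_vandermonde_eval v hg, coeff_add, coeff_C_mul,
    coeff_eq_zero_of_degree_lt hr]
  have : p.coeff n = 1 := hdeg ▸ hp.coeff_natDegree
  rw [this]
  ring

/-- The difference of two distinct variables is not a zero divisor. -/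
theorem MvPolynomial.isLeftRegular_X_sub_X {σ R : Type*} [CommRing R] {i j : σ} (hij : i ≠ j) :
    IsLeftRegular (X j - X i : MvPolynomial σ R) := by
  classical
  let φ : MvPolynomial σ R →ₐ[R] MvPolynomial σ R := aeval fun l => if l = j then X j + X i else X l
  let ψ : MvPolynomial σ R →ₐ[R] MvPolynomial σ R := aeval fun l => if l = j then X j - X i else X l
  have hψφ : ψ.comp φ = AlgHom.id R _ := by
    ext1 l
    by_cases hl : l = j <;> simp [φ, ψ, hl, hij]
  have hφ : Function.Injective φ :=
    Function.LeftInverse.injective (g := ψ) fun y => DFunLike.congr_fun hψφ y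
  intro y z h
  apply hφ
  apply (isRegular_X (n := j) (R := R)).left
  have h := congrArg φ h
  simpa [φ, hij] using h

theorem isLeftRegular_vandermondeEl (R : Type*) [CommRing R] (k : ℕ) :
    IsLeftRegular (vandermondeEl R k) :=
  IsLeftRegular.prod fun _ _ => IsLeftRegular.prod fun _ hi =>
    MvPolynomial.isLeftRegular_X_sub_X (Finset.mem_filter.mp hi).2.ne

theorem vandermondeEl_eq_det_vandermonde (R : Type*) [CommRing R] (k : ℕ) :
    vandermondeEl R k = (Matrix.vandermonde (MvPolynomial.X (R := R) : Fin k → _)).det := by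
  rw [Matrix.det_vandermonde, vandermondeEl]
  exact Finset.prod_comm' (by simp)

theorem monic_divP (R : Type*) [CommRing R] (k i : ℕ) : (divP R k i).Monic :=
  Polynomial.monic_prod_of_monic _ _ fun _ _ => Polynomial.monic_X_sub_C _

theorem natDegree_divP (R : Type*) [CommRing R] [Nontrivial R] (n : ℕ) :
    (divP R (n + 1) n).natDegree = n := by
  rw [divP, Polynomial.natDegree_prod_of_monic _ _ fun _ _ => Polynomial.monic_X_sub_C _]
  simp [Fin.card_filter_val_lt]

theorem eval_divP_of_lt (R : Type*) [CommRing R] {k i : ℕ} {j : Fin k} (hj : (j : ℕ) < i) :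
    (divP R k i).eval (MvPolynomial.X j) = 0 := by
  rw [divP, Polynomial.eval_prod]
  exact Finset.prod_eq_zero (i := j) (by simp [hj]) (by simp)

theorem vandermondeFMatrix_succ (R : Type*) [CommRing R] (n : ℕ) (f : Polynomial R) :
    vandermondeFMatrix R (n + 1) f =
      (Matrix.vandermonde MvPolynomial.X).updateCol (Fin.last n)
        fun i => (divF R (n + 1) f).eval (MvPolynomial.X i) := by
  ext1 i j
  rcases Fin.eq_castSucc_or_eq_last j with ⟨j, rfl⟩ | rfl
  · simp [vandermondeFMatrix, Matrix.vandermonde_apply]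
  · simp [vandermondeFMatrix]

/-- **Determinant formula for the relator `b_{k-1}`**: `det B_k = v_k · q_{k-1}(x_{k-1})`,
and the Vandermonde element `v_k` is not a zero divisor in `A = R[x_0, …, x_{k-1}]`. -/
theorem det_vandermondeFMatrix_eq (R : Type*) [CommRing R] (k : ℕ) (hk : 1 ≤ k)
    (f : Polynomial R) :
    (vandermondeFMatrix R k f).det =
      vandermondeEl R k *
        Polynomial.eval (MvPolynomial.X (⟨k - 1, by omega⟩ : Fin k))
          (divF R k f /ₘ divP R k (k - 1)) ∧
    ∀ y : MvPolynomial (Fin k) R, vandermondeEl R k * y = 0 → y = 0 := by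
  refine ⟨?_, fun y hy => isLeftRegular_vandermondeEl R k (by simpa using hy)⟩
  nontriviality R
  obtain ⟨n, rfl⟩ := Nat.exists_eq_add_of_le' hk
  rw [vandermondeFMatrix_succ, vandermondeEl_eq_det_vandermonde]
  exact Matrix.det_updateCol_vandermonde_eval_divByMonic _ _ (monic_divP R _ _)
    (natDegree_divP R n) fun i hi => eval_divP_of_lt R (Fin.val_lt_last hi)
end

section
/- Let R be a commutative ring, let f ∈ R[x] be monic of degree d, and let M = R[x]/(f), a free R-module with basis the images of 1, x, …, x^{d−1}. Fix k ≥ 0 and define the R-linear map Φ from the polynomial ring A = R[x_0,…,x_{k−1}] to the k-th exterior power ⋀^k_R M by sending each monomial ∏_{i<k} x_i^{a_i} to the wedge product (x^{a_0} mod f) ∧ (x^{a_1} mod f) ∧ ⋯ ∧ (x^{a_{k−1}} mod f). Then Φ vanishes on the ideal of A generated by f(x_0), …, f(x_{k−1}) together with b_0, …, b_{k−1}, where the b_i are as defined in the division scheme. -/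
open Polynomial in
/-- The monic polynomial `∏ j ∈ T, (t - x_j)` with the variables indexed by `T` as roots. -/
noncomputable def nodePoly {ι : Type*} (R : Type*) [CommRing R] (T : Finset ι) :
    (MvPolynomial ι R)[X] :=
  ∏ j ∈ T, (X - C (MvPolynomial.X j))

open Polynomial in
/-- The divided difference of `g` at the variables indexed by `T`: the coefficient of degree
`#T - 1` of the polynomial interpolating `g` at these variables. -/
noncomputable def dividedDiff {ι R : Type*} [CommRing R] (T : Finset ι) (g : R[X]) :
    MvPolynomial ι R :=
  (g.map MvPolynomial.C %ₘ nodePoly R T).coeff (T.card - 1)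

section DividedDifferences

open Polynomial

variable {ι R : Type*} [CommRing R]

lemma nodePoly_monic (T : Finset ι) : (nodePoly R T).Monic :=
  monic_prod_of_monic _ _ fun _ _ => monic_X_sub_C _

lemma nodePoly_natDegree [Nontrivial R] (T : Finset ι) : (nodePoly R T).natDegree = T.card := by
  rw [nodePoly, natDegree_prod_of_monic _ _ fun _ _ => monic_X_sub_C _]
  simp

lemma nodePoly_degree [Nontrivial R] (T : Finset ι) : (nodePoly R T).degree = T.card := by
  rw [degree_eq_natDegree (nodePoly_monic T).ne_zero, nodePoly_natDegree]

lemma nodePoly_insert [DecidableEq ι] {S : Finset ι} {j : ι} (hj : j ∉ S) :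
    nodePoly R (insert j S) = (X - C (MvPolynomial.X j)) * nodePoly R S :=
  Finset.prod_insert hj

/-- Newton's form of the divided difference. -/
lemma dividedDiff_insert [DecidableEq ι] {S : Finset ι} {j : ι} (hj : j ∉ S) (g : R[X]) :
    dividedDiff (insert j S) g =
      (g.map MvPolynomial.C /ₘ nodePoly R S).eval (MvPolynomial.X j) := by
  nontriviality R
  set G : (MvPolynomial ι R)[X] := g.map MvPolynomial.C
  set q := G /ₘ nodePoly R S with hq
  have hdeg : (G %ₘ nodePoly R S).degree < S.card := by
    rw [← nodePoly_degree (R := R) S]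
    exact degree_modByMonic_lt _ (nodePoly_monic S)
  have hlow : (C (q.eval (MvPolynomial.X j)) * nodePoly R S).degree ≤ S.card := by
    rw [← nodePoly_degree (R := R) S]
    rw [← smul_eq_C_mul]
    exact degree_smul_le _ _
  have hmod : G %ₘ nodePoly R (insert j S) =
      C (q.eval (MvPolynomial.X j)) * nodePoly R S + G %ₘ nodePoly R S := by
    refine (div_modByMonic_unique (q /ₘ (X - C (MvPolynomial.X j))) _
      (nodePoly_monic _) ⟨?_, ?_⟩).2
    · have h1 := modByMonic_add_div G (nodePoly R S)
      have h2 := modByMonic_add_div q (X - C (MvPolynomial.X j))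
      rw [modByMonic_X_sub_C_eq_C_eval] at h2
      rw [← hq] at h1
      rw [nodePoly_insert hj]
      linear_combination h1 + nodePoly R S * h2
    · rw [nodePoly_degree, Finset.card_insert_of_notMem hj]
      refine lt_of_le_of_lt ((degree_add_le _ _).trans (max_le hlow hdeg.le)) ?_
      exact_mod_cast Nat.lt_succ_self _
  have hc : (nodePoly R S).coeff S.card = 1 := by
    have := (nodePoly_monic (R := R) S).coeff_natDegree
    rwa [nodePoly_natDegree] at this
  rw [dividedDiff, hmod, Finset.card_insert_of_notMem hj, Nat.add_sub_cancel, coeff_add,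
    coeff_C_mul, hc, coeff_eq_zero_of_degree_lt hdeg, mul_one, add_zero]

lemma dividedDiff_singleton [DecidableEq ι] (j : ι) (g : R[X]) :
    dividedDiff {j} g = (g.map MvPolynomial.C).eval (MvPolynomial.X j) := by
  rw [← insert_empty_eq j, dividedDiff_insert (Finset.notMem_empty j)]
  simp [nodePoly]

/-- Leibniz rule for divided differences of `t * g`. -/
lemma X_mul_dividedDiff_insert [DecidableEq ι] {S : Finset ι} {l : ι} (hl : l ∉ S)
    (hS : S.Nonempty) (g : R[X]) :
    MvPolynomial.X l * dividedDiff (insert l S) g =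
      dividedDiff (insert l S) (X * g) - dividedDiff S g := by
  nontriviality R
  set G : (MvPolynomial ι R)[X] := g.map MvPolynomial.C with hG
  obtain ⟨n, hn⟩ : ∃ n, S.card = n + 1 := Nat.exists_eq_succ_of_ne_zero hS.card_pos.ne'
  have hdeg : (G %ₘ nodePoly R S).degree < S.card := by
    rw [← nodePoly_degree (R := R) S]
    exact degree_modByMonic_lt _ (nodePoly_monic S)
  have hmod : (X * G - C (MvPolynomial.X l) * G) %ₘ nodePoly R (insert l S) =
      (X - C (MvPolynomial.X l)) * (G %ₘ nodePoly R S) := by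
    refine (div_modByMonic_unique (G /ₘ nodePoly R S) _ (nodePoly_monic _) ⟨?_, ?_⟩).2
    · have h1 := modByMonic_add_div G (nodePoly R S)
      rw [nodePoly_insert hl]
      linear_combination (X - C (MvPolynomial.X l)) * h1
    · rw [nodePoly_insert hl, (monic_X_sub_C _).degree_mul_comm, (monic_X_sub_C _).degree_mul_comm,
        (monic_X_sub_C _).degree_mul, (monic_X_sub_C _).degree_mul, nodePoly_degree,
        degree_X_sub_C]
      exact WithBot.add_lt_add_right (by simp) hdeg
  have hcoeff := congrArg (fun p => p.coeff S.card) hmod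
  simp only [sub_modByMonic, ← smul_eq_C_mul, smul_modByMonic, coeff_sub, coeff_smul, sub_mul,
    hn, coeff_X_mul, smul_eq_mul] at hcoeff
  rw [← hn, coeff_eq_zero_of_degree_lt hdeg, hn] at hcoeff
  simp only [dividedDiff, Finset.card_insert_of_notMem hl, hn, Nat.add_sub_cancel,
    Polynomial.map_mul, map_X, ← hG]
  linear_combination -hcoeff

lemma rename_dividedDiff (σ : Equiv.Perm ι) {T : Finset ι}
    (hσ : T.map σ.toEmbedding = T) (g : R[X]) :
    MvPolynomial.rename σ (dividedDiff T g) = dividedDiff T g := by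
  have hnode : (nodePoly R T).map (MvPolynomial.rename σ : _ →ₐ[R] _).toRingHom =
      nodePoly R T := by
    conv_rhs => rw [← hσ]
    simp [nodePoly, Polynomial.map_prod]
  have hg : (g.map MvPolynomial.C).map
      (MvPolynomial.rename σ : MvPolynomial ι R →ₐ[R] _).toRingHom = g.map MvPolynomial.C := by
    rw [Polynomial.map_map]
    congr 1
    ext1 r
    simp
  have h := map_modByMonic (MvPolynomial.rename σ : MvPolynomial ι R →ₐ[R] _).toRingHom
    (p := g.map MvPolynomial.C) (nodePoly_monic (R := R) T)
  rw [hg, hnode] at h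
  have := congrArg (fun p => p.coeff (T.card - 1)) h
  simpa [dividedDiff] using this

end DividedDifferences

section AlternatingMonomials

open Polynomial

variable {ι R N : Type*} [CommRing R] [AddCommGroup N] [Module R N] [DecidableEq ι]
  {φ : R[X] [⋀^ι]→ₗ[R] N} {Φ : MvPolynomial ι R →ₗ[R] N}

/-- An alternating functional on polynomials kills every polynomial that is symmetric in two
distinct variables. -/
lemma map_eq_zero_of_rename_swap_eq
    (hΦ : ∀ s : ι →₀ ℕ, Φ (MvPolynomial.monomial s 1) = φ fun i => X ^ s i)
    {p q : ι} (hpq : p ≠ q) {P : MvPolynomial ι R}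
    (hP : MvPolynomial.rename (Equiv.swap p q) P = P) : Φ P = 0 := by
  set σ := Equiv.swap p q with hσ
  have hmon (s : ι →₀ ℕ) (c : R) :
      Φ (MvPolynomial.monomial s c) = c • φ fun i => X ^ s i := by
    rw [← hΦ, ← map_smul, MvPolynomial.smul_monomial, smul_eq_mul, mul_one]
  have happ (s : ι →₀ ℕ) (i : ι) : s.mapDomain σ i = s (σ i) := by
    rw [← Finsupp.equivMapDomain_eq_mapDomain, Finsupp.equivMapDomain_apply, hσ, Equiv.symm_swap]
  have hcoeff (s : ι →₀ ℕ) : P.coeff (s.mapDomain σ) = P.coeff s := by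
    conv_lhs => rw [← hP]
    exact MvPolynomial.coeff_rename_mapDomain _ σ.injective _ _
  rw [P.as_sum, map_sum]
  refine Finset.sum_involution (fun s _ => s.mapDomain σ) ?_ ?_ ?_ ?_
  · intro s _
    rw [hmon, hmon, hcoeff, ← smul_add]
    have : (fun i => (X : R[X]) ^ (s.mapDomain σ) i) = (fun i => (X : R[X]) ^ s i) ∘ σ := by
      ext1 i
      simp [happ]
    rw [this, φ.map_swap _ hpq, add_neg_cancel, smul_zero]
  · intro s _ hne hfix
    refine hne ?_
    rw [hmon, φ.map_eq_zero_of_eq _ _ hpq, smul_zero]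
    have := happ s p
    rw [hfix, hσ, Equiv.swap_apply_left] at this
    simp [this]
  · intro s hs
    rw [MvPolynomial.mem_support_iff] at hs ⊢
    rwa [hcoeff]
  · intro s _
    ext i
    simp [hσ]

lemma map_monomial_mul_eval
    (hΦ : ∀ s : ι →₀ ℕ, Φ (MvPolynomial.monomial s 1) = φ fun i => X ^ s i)
    (s : ι →₀ ℕ) (j : ι) (g : R[X]) :
    Φ (MvPolynomial.monomial s 1 * (g.map MvPolynomial.C).eval (MvPolynomial.X j)) =
      φ (Function.update (fun i => X ^ s i) j (X ^ s j * g)) := by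
  induction g using Polynomial.induction_on' with
  | add g h hg hh =>
    rw [Polynomial.map_add, eval_add, mul_add, map_add, hg, hh, mul_add, φ.map_update_add]
  | monomial n c =>
    have h1 : MvPolynomial.monomial s (1 : R) *
        ((monomial n c).map MvPolynomial.C).eval (MvPolynomial.X j) =
        c • MvPolynomial.monomial (s + Finsupp.single j n) 1 := by
      rw [map_monomial, eval_monomial, MvPolynomial.X_pow_eq_monomial, mul_left_comm,
        MvPolynomial.monomial_mul, MvPolynomial.smul_eq_C_mul, one_mul]
    have h2 : (X : R[X]) ^ s j * monomial n c = c • X ^ (s j + n) := by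
      rw [← C_mul_X_pow_eq_monomial, smul_eq_C_mul]
      ring
    rw [h1, h2, map_smul, hΦ, φ.map_update_smul]
    congr 2
    ext1 i
    rcases eq_or_ne i j with rfl | hij
    · simp
    · simp [hij, Finsupp.single_eq_of_ne hij]

/-- If `φ` vanishes as soon as one argument is a multiple of `f`, then `Φ` vanishes on the ideal
multiples of all divided differences of multiples of `f`. -/
lemma map_mul_dividedDiff_eq_zero
    (hΦ : ∀ s : ι →₀ ℕ, Φ (MvPolynomial.monomial s 1) = φ fun i => X ^ s i)
    {f : R[X]} (hφ : ∀ (v : ι → R[X]) (j : ι), f ∣ v j → φ v = 0)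
    {T : Finset ι} (hT : T.Nonempty) {g : R[X]} (hg : f ∣ g) (m : MvPolynomial ι R) :
    Φ (m * dividedDiff T g) = 0 := by
  suffices h : ∀ s : ι →₀ ℕ, Φ (MvPolynomial.monomial s 1 * dividedDiff T g) = 0 by
    rw [m.as_sum, Finset.sum_mul, map_sum]
    refine Finset.sum_eq_zero fun s _ => ?_
    have hs : MvPolynomial.monomial s (m.coeff s) = m.coeff s • MvPolynomial.monomial s 1 := by
      rw [MvPolynomial.smul_monomial, smul_eq_mul, mul_one]
    rw [hs, smul_mul_assoc, map_smul, h s, smul_zero]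
  intro s
  clear m
  induction hT using Finset.Nonempty.strong_induction generalizing g s with
  | h₀ j =>
    rw [dividedDiff_singleton, map_monomial_mul_eval hΦ]
    refine hφ _ j ?_
    rw [Function.update_self]
    exact hg.mul_left _
  | @h₁ T hT ih =>
    induction hn : ∑ i ∈ T, s i generalizing g s with
    | zero =>
      obtain ⟨p, hp, q, hq, hpq⟩ := hT
      have hs (i : ι) (hi : i ∈ T) : s i = 0 := Finset.sum_eq_zero_iff.mp hn i hi
      have hfix : s.mapDomain (Equiv.swap p q) = s := by
        ext i
        rw [← Finsupp.equivMapDomain_eq_mapDomain, Finsupp.equivMapDomain_apply,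
          Equiv.symm_swap, Equiv.swap_apply_def]
        split_ifs with h1 h2
        · rw [h1, hs p hp, hs q hq]
        · rw [h2, hs p hp, hs q hq]
        · rfl
      refine map_eq_zero_of_rename_swap_eq hΦ hpq ?_
      rw [map_mul, MvPolynomial.rename_monomial, hfix, rename_dividedDiff]
      ext i
      rw [Finset.mem_map_equiv, Equiv.symm_swap, Equiv.swap_apply_def]
      split_ifs with h1 h2
      · exact h1 ▸ iff_of_true hq hp
      · exact h2 ▸ iff_of_true hp hq
      · rfl
    | succ n ihn =>
      obtain ⟨l, hl, hsl⟩ : ∃ l ∈ T, s l ≠ 0 := Finset.exists_ne_zero_of_sum_ne_zero (by omega)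
      obtain ⟨s', rfl⟩ : ∃ s', s = s' + Finsupp.single l 1 :=
        ⟨s - Finsupp.single l 1, (tsub_add_cancel_of_le (by simpa [Nat.one_le_iff_ne_zero])).symm⟩
      have hne : (T.erase l).Nonempty := (Finset.erase_nonempty hl).mpr hT
      have hleib := X_mul_dividedDiff_insert (Finset.notMem_erase l T) hne g
      rw [Finset.insert_erase hl] at hleib
      have hn' : ∑ i ∈ T, s' i = n := by
        have : ∑ i ∈ T, (Finsupp.single l 1 : ι →₀ ℕ) i = 1 := by
          simp [Finsupp.single_apply, hl]
        simp only [Finsupp.add_apply, Finset.sum_add_distrib, this] at hn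
        omega
      rw [← mul_one (1 : R), ← MvPolynomial.monomial_mul, mul_assoc, ← MvPolynomial.X, hleib,
        mul_sub, map_sub, ihn (hg.mul_left X) s' hn',
        ih _ hne (Finset.erase_ssubset hl) hg s', sub_zero]

end AlternatingMonomials

/-- **The defining ideal of `P_k(D)` maps to zero in the exterior power.**  Let `f` be
monic of degree `d`, and `M = R[x]/(f)`, a free `R`-module with basis `1, x, …, x^{d-1}`.
If `Φ : A → ⋀^k_R M` is the `R`-linear map sending each monomial `∏ x_i^{a_i}` to the
wedge `(x^{a_0} mod f) ∧ ⋯ ∧ (x^{a_{k-1}} mod f)`, then `Φ` vanishes on the ideal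
generated by the `f(x_i)` together with the `b_i` of the division scheme. -/
theorem wedge_map_vanishes_on_Jk {R : Type*} [CommRing R] (d k : ℕ) (f : Polynomial R)
    (hf : f.Monic) (hfd : f.natDegree = d)
    (Φ : MvPolynomial (Fin k) R →ₗ[R] ⋀[R]^k (Polynomial R ⧸ Ideal.span {f}))
    (hΦ : ∀ a : Fin k → ℕ,
      (Φ (∏ i : Fin k, MvPolynomial.X i ^ a i) : ExteriorAlgebra R (Polynomial R ⧸ Ideal.span {f})) =
        ExteriorAlgebra.ιMulti R k
          (fun i => Ideal.Quotient.mk (Ideal.span {f}) (Polynomial.X ^ a i))) :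
    ∀ z ∈ Ideal.span
        (Set.range (fun i : Fin k => Polynomial.eval (MvPolynomial.X i) (divF R k f)) ∪
          Set.range (divB R k f)),
      Φ z = 0 := by
  let φ : Polynomial R [⋀^Fin k]→ₗ[R] ExteriorAlgebra R (Polynomial R ⧸ Ideal.span {f}) :=
    (ExteriorAlgebra.ιMulti R k).compLinearMap (Ideal.Quotient.mkₐ R (Ideal.span {f})).toLinearMap
  let Ψ := (⋀[R]^k (Polynomial R ⧸ Ideal.span {f})).subtype ∘ₗ Φ
  have hΨ (s : Fin k →₀ ℕ) :
      Ψ (MvPolynomial.monomial s 1) = φ fun i => Polynomial.X ^ s i := by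
    rw [MvPolynomial.monomial_eq, MvPolynomial.C_1, one_mul, Finsupp.prod_fintype _ _ (by simp)]
    exact hΦ s
  have hφ (v : Fin k → Polynomial R) (j : Fin k) (hv : f ∣ v j) : φ v = 0 := by
    refine (ExteriorAlgebra.ιMulti R k).map_coord_zero j ?_
    exact Ideal.Quotient.eq_zero_iff_mem.mpr (Ideal.mem_span_singleton.mpr hv)
  intro z hz
  suffices h : ∀ m, Ψ (m * z) = 0 from Subtype.ext (by simpa [Ψ] using h 1)
  induction hz using Submodule.span_induction with
  | mem z hz =>
    intro m
    rcases hz with ⟨i, rfl⟩ | ⟨i, rfl⟩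
    · have := map_mul_dividedDiff_eq_zero hΨ hφ (Finset.singleton_nonempty i) dvd_rfl m
      rwa [dividedDiff_singleton] at this
    · have hi : i ∉ Finset.univ.filter (fun j : Fin k => (j : ℕ) < i) := by simp
      have := map_mul_dividedDiff_eq_zero hΨ hφ (Finset.insert_nonempty i
        (Finset.univ.filter fun j : Fin k => (j : ℕ) < i)) dvd_rfl m
      rwa [dividedDiff_insert hi] at this
  | zero => simp
  | add x y _ _ hx hy => intro m; rw [mul_add, map_add, hx, hy, add_zero]
  | smul a x _ hx => intro m; rw [smul_eq_mul, ← mul_assoc, hx]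
end

section
/- Let R be a commutative ring, and let ι and κ be (possibly infinite) index sets. Let M be the product of copies of the power series ring R⟦X⟧ indexed by ι, and N the product of copies of R⟦X⟧ indexed by κ, regarded as modules over R⟦X⟧, and let α : M → N be an R⟦X⟧-linear map. If the induced map M/XM → N/XN is bijective, then α is bijective. -/
open PowerSeries in
/-- A sequence with `d k = X • d (k + 1)` vanishes, since its terms are infinitely `X`-divisible. -/
theorem PowerSeries.pi_eq_zero_of_eq_X_smul_succ {R ι : Type*} [CommRing R]
    (d : ℕ → ι → R⟦X⟧) (hd : ∀ k, d k = (X : R⟦X⟧) • d (k + 1)) (k : ℕ) : d k = 0 := by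
  suffices H : ∀ n k i, coeff n (d k i) = 0 by
    ext i n
    simpa using H n k i
  intro n
  induction n with
  | zero => intro k i; rw [hd k]; simp
  | succ n ih => intro k i; rw [hd k]; simpa [coeff_succ_X_mul] using ih (k + 1) i

open PowerSeries in
/-- The sum `∑ k, X ^ k • f k` in a product of copies of `R⟦X⟧`. -/
noncomputable def PowerSeries.piSumXPow {R ι : Type*} [CommRing R] (f : ℕ → ι → R⟦X⟧) (i : ι) : R⟦X⟧ :=
  .mk fun n ↦ ∑ k ∈ Finset.range (n + 1), coeff (n - k) (f k i)

open PowerSeries in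
theorem PowerSeries.piSumXPow_eq_add_X_smul {R ι : Type*} [CommRing R] (f : ℕ → ι → R⟦X⟧) :
    piSumXPow f = f 0 + (X : R⟦X⟧) • piSumXPow fun k ↦ f (k + 1) := by
  ext i n
  cases n with
  | zero => simp [piSumXPow]
  | succ n =>
    simp [piSumXPow, coeff_succ_X_mul, Finset.sum_range_succ' _ (n + 1), add_comm (coeff _ _)]

open PowerSeries in
theorem PowerSeries.X_smul_pi_injective {R ι : Type*} [CommRing R] :
    Function.Injective fun m : ι → R⟦X⟧ ↦ (X : R⟦X⟧) • m := by
  intro a b hab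
  ext i n
  simpa [coeff_succ_X_mul] using congrArg (coeff (n + 1)) (congrFun hab i)

/-- Let `M` and `N` be products of copies of the power series ring `R⟦X⟧` (indexed by
arbitrary sets `ι` and `κ`), and let `α : M → N` be an `R⟦X⟧`-linear map.  If the induced
map `M/XM → N/XN` is bijective, then `α` is bijective. -/
theorem bijective_of_bijective_mod_X {R : Type*} [CommRing R] {ι κ : Type*}
    (α : (ι → PowerSeries R) →ₗ[PowerSeries R] (κ → PowerSeries R))
    (h : Function.Bijective (Submodule.mapQ
      (LinearMap.range ((PowerSeries.X : PowerSeries R) •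
        (LinearMap.id : (ι → PowerSeries R) →ₗ[PowerSeries R] (ι → PowerSeries R))))
      (LinearMap.range ((PowerSeries.X : PowerSeries R) •
        (LinearMap.id : (κ → PowerSeries R) →ₗ[PowerSeries R] (κ → PowerSeries R))))
      α (by
        rintro x ⟨m, rfl⟩
        exact ⟨α m, by simp⟩))) :
    Function.Bijective α := by
  have inj_mod (m) (n) (hm : α m = (PowerSeries.X : PowerSeries R) • n) :
      ∃ m', m = (PowerSeries.X : PowerSeries R) • m' := by
    have hmk := (injective_iff_map_eq_zero _).1 h.1 (Submodule.Quotient.mk m) <|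
      (Submodule.Quotient.mk_eq_zero _).2 ⟨n, by simp [hm]⟩
    obtain ⟨m', hm'⟩ := (Submodule.Quotient.mk_eq_zero _).1 hmk
    exact ⟨m', by simpa using hm'.symm⟩
  have surj_mod (n) : ∃ m n', n = α m + (PowerSeries.X : PowerSeries R) • n' := by
    obtain ⟨q, hq⟩ := h.2 (Submodule.Quotient.mk n)
    obtain ⟨m, rfl⟩ := Submodule.Quotient.mk_surjective _ q
    obtain ⟨n', hn'⟩ := (Submodule.Quotient.eq (x := n) (y := α m) _).1 hq.symm
    exact ⟨m, n', by rw [← sub_eq_iff_eq_add']; simpa using hn'.symm⟩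
  constructor
  · refine (injective_iff_map_eq_zero α).2 fun m hm ↦ ?_
    have step (x : LinearMap.ker α) :
        ∃ y : LinearMap.ker α, x.1 = (PowerSeries.X : PowerSeries R) • y.1 := by
      obtain ⟨y, hy⟩ := inj_mod x.1 0 (by simp)
      refine ⟨⟨y, PowerSeries.X_smul_pi_injective ?_⟩, hy⟩
      simp [← map_smul, ← hy]
    choose g hg using step
    exact PowerSeries.pi_eq_zero_of_eq_X_smul_succ (fun k ↦ (g^[k] ⟨m, hm⟩).1)
      (fun k ↦ by rw [Function.iterate_succ_apply']; exact hg _) 0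
  · intro n
    choose f g hfg using surj_mod
    refine ⟨PowerSeries.piSumXPow fun k ↦ f (g^[k] n), ?_⟩
    have hd := PowerSeries.pi_eq_zero_of_eq_X_smul_succ
      (fun k ↦ g^[k] n - α (PowerSeries.piSumXPow fun j ↦ f (g^[j + k] n))) (fun k ↦ by
        rw [PowerSeries.piSumXPow_eq_add_X_smul, map_add, map_smul, smul_sub]
        nth_rw 1 [hfg (g^[k] n)]
        simp only [Function.iterate_succ_apply', zero_add, add_right_comm _ 1 k, ← add_assoc]
        abel) 0
    exact (sub_eq_zero.1 hd).symm
end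

section
/- Let X be a closed subset of ℂ and n a natural number. Let N(X) denote the set of matrices A ∈ M_n(ℂ) that are normal (A commutes with its conjugate transpose) and whose spectrum is contained in X, with the subspace topology from M_n(ℂ), and give the space C(X, ℂ) of continuous maps X → ℂ the compact-open topology (uniform convergence on compact sets). Then the map C(X, ℂ) × N(X) → M_n(ℂ) sending (f, A) to f(A), the continuous functional calculus of f applied to A (the normal matrix acting with eigenvalue f(λ) on the λ-eigenspace of A for each eigenvalue λ of A), is continuous. -/
section CStarAlgebra

open Topology UniformOnFun

/-- If continuous maps `f y : X → ℂ` on a closed set `X` and normal elements `a y` with spectrum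
in `X` depend continuously on `y`, then so does the functional calculus of `f y` at `a y`. -/
theorem Continuous.cfc_extend {Y A : Type*} [TopologicalSpace Y] [CStarAlgebra A]
    {X : Set ℂ} (hX : IsClosed X) {f : Y → C(X, ℂ)} {a : Y → A}
    (hf : Continuous f) (ha : Continuous a) (hnormal : ∀ y, IsStarNormal (a y))
    (hspec : ∀ y, spectrum ℂ (a y) ⊆ X) :
    Continuous fun y ↦ cfc (Function.extend Subtype.val (f y) 0) (a y) := by
  rw [continuous_iff_continuousAt]
  intro y₀
  have hext (g : C(X, ℂ)) (x : X) : Function.extend Subtype.val g 0 (x : ℂ) = g x :=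
    Subtype.val_injective.extend_apply _ _ _
  set r := ‖a y₀‖ * ‖(1 : A)‖ + 1
  set K := X ∩ Metric.closedBall (0 : ℂ) r
  have hK : IsCompact K := (isCompact_closedBall 0 r).inter_left hX
  have hspecK : ∀ᶠ y in 𝓝 y₀, spectrum ℂ (a y) ⊆ K := by
    have hlt : ∀ᶠ y in 𝓝 y₀, ‖a y‖ * ‖(1 : A)‖ < r :=
      (ha.norm.mul continuous_const).continuousAt.eventually_lt continuousAt_const (lt_add_one _)
    filter_upwards [hlt] with y hy
    exact Set.subset_inter (hspec y) <| (spectrum.subset_closedBall_norm_mul (a y)).trans <|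
      Metric.closedBall_subset_closedBall hy.le
  have hcont (g : C(X, ℂ)) : ContinuousOn (Function.extend Subtype.val g 0) K := by
    refine ContinuousOn.mono (continuousOn_iff_continuous_domRestrict.mpr ?_)
      Set.inter_subset_left
    convert! g.continuous using 1
    exact funext (hext g)
  have hunif : Filter.Tendsto (fun y ↦ ofFun {K} (Function.extend Subtype.val (f y) 0)) (𝓝 y₀)
      (𝓝 (ofFun {K} (Function.extend Subtype.val (f y₀) 0))) := by
    simp only [UniformOnFun.tendsto_iff_tendstoUniformlyOn, Set.mem_singleton_iff, forall_eq]
    have h := ContinuousMap.tendsto_iff_forall_isCompact_tendstoUniformlyOn.mp (hf.tendsto y₀)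
      (Subtype.val ⁻¹' K) (hX.isClosedEmbedding_subtypeVal.isCompact_preimage hK)
    intro u hu
    filter_upwards [h u hu] with y hy x hx
    simpa [hext _ ⟨x, hx.1⟩] using hy ⟨x, hx.1⟩ hx
  have hjoint := continuousOn_cfc_setProd (A := A) hK
    (ofFun {K} (Function.extend Subtype.val (f y₀) 0), a y₀)
    ⟨hcont (f y₀), hnormal y₀, hspecK.self_of_nhds⟩
  refine hjoint.tendsto.comp
    (tendsto_nhdsWithin_iff.mpr ⟨hunif.prodMk_nhds (ha.tendsto y₀), ?_⟩)
  filter_upwards [hspecK] with y hy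
  exact ⟨hcont (f y), hnormal y, hy⟩

end CStarAlgebra

section Matrix

open scoped Matrix.Norms.L2Operator

/-- A matrix acting as the scalar `g μ` on each `μ`-eigenspace of a normal matrix `A` is the
continuous functional calculus of `g` at `A`. -/
theorem Matrix.eq_cfc_of_mulVec_eigenvector {n : Type*} [Fintype n] [DecidableEq n]
    {A B : Matrix n n ℂ} [IsStarNormal A] (g : ℂ → ℂ)
    (h : ∀ μ ∈ spectrum ℂ A, ∀ v : n → ℂ, A.mulVec v = μ • v → B.mulVec v = g μ • v) :
    B = cfc g A := by
  have hfin := A.finite_spectrum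
  have hcont (k : ℂ → ℂ) : ContinuousOn k (spectrum ℂ A) := hfin.continuousOn k
  set e : ℂ → ℂ → ℂ := fun μ ↦ Pi.single μ 1
  have heigen (μ : ℂ) : A * cfc (e μ) A = μ • cfc (e μ) A := by
    nth_rw 1 [← cfc_id' ℂ A]
    rw [← cfc_mul _ _ A (hcont _) (hcont _), ← cfc_const_mul μ _ A (hcont _)]
    refine cfc_congr fun x _ ↦ ?_
    by_cases hx : x = μ <;> simp [e, hx]
  have hB (μ : ℂ) (hμ : μ ∈ spectrum ℂ A) : B * cfc (e μ) A = g μ • cfc (e μ) A := by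
    ext i j
    refine congrFun (h μ hμ (fun k ↦ cfc (e μ) A k j) ?_) i
    exact funext fun i ↦ congrFun (congrFun (heigen μ) i) j
  have hone : ∑ μ ∈ hfin.toFinset, cfc (e μ) A = 1 := by
    rw [← cfc_sum _ A _ fun _ _ ↦ hcont _, ← cfc_one ℂ A]
    refine cfc_congr fun x hx ↦ ?_
    simpa [e, Finset.sum_apply, Pi.single_apply] using hx
  calc
    B = ∑ μ ∈ hfin.toFinset, B * cfc (e μ) A := by rw [← Finset.mul_sum, hone, mul_one]
    _ = ∑ μ ∈ hfin.toFinset, cfc (fun x ↦ g μ * e μ x) A :=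
      Finset.sum_congr rfl fun μ hμ ↦ by
        rw [hB μ (hfin.mem_toFinset.mp hμ), cfc_const_mul _ _ A (hcont _)]
    _ = cfc g A := by
      rw [← cfc_sum _ A _ fun _ _ ↦ hcont _]
      refine cfc_congr fun x hx ↦ ?_
      simp only [e, Finset.sum_apply, Pi.single_apply, mul_ite, mul_one, mul_zero]
      simp [hx]

end Matrix

/-- Let `X` be a closed subset of `ℂ` and `N(X)` the set of normal `n × n` complex
matrices whose spectrum is contained in `X`, with the subspace topology from `M_n(ℂ)`.
Suppose `E : C(X, ℂ) × N(X) → M_n(ℂ)` is the functional calculus, i.e. for every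
`(f, A)`, the matrix `E (f, A)` acts with eigenvalue `f λ` on each eigenvector of `A`
with eigenvalue `λ ∈ X`.  Then `E` is continuous (where `C(X, ℂ)` carries the
compact-open topology). -/
theorem continuous_functional_calculus_normal_matrices
    (X : Set ℂ) (hX : IsClosed X) (n : ℕ)
    (E : C(X, ℂ) ×
      {A : Matrix (Fin n) (Fin n) ℂ // A * A.conjTranspose = A.conjTranspose * A ∧
        spectrum ℂ A ⊆ X} → Matrix (Fin n) (Fin n) ℂ)
    (hE : ∀ (f : C(X, ℂ))
      (A : {A : Matrix (Fin n) (Fin n) ℂ // A * A.conjTranspose = A.conjTranspose * A ∧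
        spectrum ℂ A ⊆ X})
      (lam : X) (v : Fin n → ℂ),
        A.1.mulVec v = (lam : ℂ) • v → (E (f, A)).mulVec v = f lam • v) :
    Continuous E := by
  have hnormal (p : C(X, ℂ) × {A : Matrix (Fin n) (Fin n) ℂ //
      A * A.conjTranspose = A.conjTranspose * A ∧ spectrum ℂ A ⊆ X}) : IsStarNormal p.2.1 :=
    ⟨p.2.2.1.symm⟩
  open scoped Matrix.Norms.L2Operator in
  convert! Continuous.cfc_extend hX continuous_fst (continuous_subtype_val.comp continuous_snd)
    hnormal (fun p ↦ p.2.2.2) using 2 with p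
  have : IsStarNormal ((Subtype.val ∘ Prod.snd) p) := hnormal p
  refine Matrix.eq_cfc_of_mulVec_eigenvector _ fun μ hμ v hv ↦ ?_
  rw [hE p.1 p.2 ⟨μ, p.2.2.2 hμ⟩ v hv]
  exact congrArg (· • v) (Subtype.val_injective.extend_apply p.1 0 ⟨μ, p.2.2.2 hμ⟩).symm
end
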